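/- Consider the ABP system G_a' with the forward channel under person-in-the-middle attack and with the dead transitions removed (sender transitions s0−a0'→s0, s2−send→s1, s4−a1'→s5, s6−send→s5 and sending-client transition c0−done→c0 deleted), with uncontrollable events Σ_uc = {send, done, timeout, deliver, p0, p1, a0, a1} and observable events Σ_o = {p0, p1, p0', p1', a0, a1, a0', a1'} with natural projection P. Let M = { s ∈ L(G_a') : the subsequence of s over {send, deliver} is not a prefix of the alternating sequence send, deliver, send, deliver, … }. Then M is controllable with respect to (L(G_a'), Σ_uc), normal with respect to (L(G_a'), P), and pr(M) = L(G_a'); in particular the string send · p0 · p0' · deliver · a0 · p1' · deliver belongs to M. -/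

import Mathlib

/-! Model of the Alternating Bit Protocol (ABP) as a synchronous composition of
finite-state automata, following Alur et al. and the paper's Section 4. -/

/-- Events of the ABP system. -/
inductive Ev
  | send | done | timeout | deliver
  | p0 | p1 | p0' | p1'
  | a0 | a1 | a0' | a1'
  deriving DecidableEq

/-- Sender states. -/
inductive SSt | s0 | s1 | s2 | s3 | s4 | s5 | s6 | s7 deriving DecidableEq
/-- Receiver states. -/
inductive RSt | r0 | r1 | r2 | r3 | r4 | r5 deriving DecidableEq
/-- Forward channel states. -/
inductive FSt | f0 | f1 | f2 deriving DecidableEq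
/-- Backward channel states. -/
inductive BSt | b0 | b1 | b2 deriving DecidableEq
/-- Sending client states. -/
inductive CSt | c0 | c1 deriving DecidableEq

/-- Sender (ABP sender) transitions. -/
def sndTrans : List (SSt × Ev × SSt) :=
  [(.s0, .a0', .s0), (.s0, .a1', .s0), (.s0, .timeout, .s0), (.s0, .send, .s1),
   (.s1, .p0, .s2), (.s2, .send, .s1), (.s2, .timeout, .s1), (.s2, .a1', .s2), (.s2, .a0', .s3),
   (.s3, .done, .s4), (.s4, .a0', .s4), (.s4, .timeout, .s4), (.s4, .send, .s5), (.s4, .a1', .s5),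
   (.s5, .p1, .s6), (.s6, .send, .s5), (.s6, .timeout, .s5), (.s6, .a1', .s7), (.s7, .done, .s0)]

/-- Receiver (ABP receiver) transitions. -/
def rcvTrans : List (RSt × Ev × RSt) :=
  [(.r0, .p0', .r1), (.r0, .p1', .r5), (.r1, .deliver, .r2), (.r2, .a0, .r3),
   (.r3, .p0', .r2), (.r3, .p1', .r4), (.r4, .deliver, .r0), (.r5, .a1, .r0)]

/-- Nominal (nondeterministic) forward channel transitions. -/
def fcTrans : List (FSt × Ev × FSt) :=
  [(.f0, .p0, .f0), (.f0, .p1, .f0), (.f0, .p0, .f1), (.f0, .p1, .f2),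
   (.f1, .p0, .f1), (.f1, .p1, .f1), (.f1, .p0', .f1), (.f1, .p0', .f0),
   (.f2, .p0, .f2), (.f2, .p1, .f2), (.f2, .p1', .f2), (.f2, .p1', .f0)]

/-- Nominal (nondeterministic) backward channel transitions. -/
def bcTrans : List (BSt × Ev × BSt) :=
  [(.b0, .a0, .b0), (.b0, .a1, .b0), (.b0, .a0, .b1), (.b0, .a1, .b2),
   (.b1, .a0, .b1), (.b1, .a1, .b1), (.b1, .a0', .b1), (.b1, .a0', .b0),
   (.b2, .a0, .b2), (.b2, .a1, .b2), (.b2, .a1', .b2), (.b2, .a1', .b0)]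

/-- Sending client transitions. -/
def scTrans : List (CSt × Ev × CSt) :=
  [(.c0, .done, .c0), (.c0, .send, .c1), (.c1, .done, .c0)]

/-- Component alphabets. -/
def sndAlph (e : Ev) : Prop := e ∈ ([.send, .done, .timeout, .p0, .p1, .a0', .a1'] : List Ev)
def rcvAlph (e : Ev) : Prop := e ∈ ([.deliver, .p0', .p1', .a0, .a1] : List Ev)
def fcAlph (e : Ev) : Prop := e ∈ ([.p0, .p1, .p0', .p1'] : List Ev)
def bcAlph (e : Ev) : Prop := e ∈ ([.a0, .a1, .a0', .a1'] : List Ev)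
def scAlph (e : Ev) : Prop := e ∈ ([.send, .done] : List Ev)

/-- Synchronization of one component: if the event is in the component's alphabet, the
component must execute a transition on it; otherwise the component does not move.
(The one-state receiving client with self-loop `deliver` and the one-state timer with
self-loop `timeout` never constrain nor change anything, so they are left implicit.) -/
def sync {Q : Type*} (alph : Ev → Prop) (trans : List (Q × Ev × Q))
    (q : Q) (e : Ev) (q' : Q) : Prop :=
  (alph e ∧ (q, e, q') ∈ trans) ∨ (¬ alph e ∧ q' = q)

/-- Global states of the ABP system. -/
structure GSt where
  snd : SSt
  rcv : RSt
  fc : FSt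
  bc : BSt
  sc : CSt
  deriving DecidableEq

/-- Global step of the synchronous composition, parametrized by the sender, forward
channel and sending-client transition lists (these vary across the setups). -/
def gstep (sT : List (SSt × Ev × SSt)) (fT : List (FSt × Ev × FSt))
    (cT : List (CSt × Ev × CSt)) (q : GSt) (e : Ev) (q' : GSt) : Prop :=
  sync sndAlph sT q.snd e q'.snd ∧
  sync rcvAlph rcvTrans q.rcv e q'.rcv ∧
  sync fcAlph fT q.fc e q'.fc ∧
  sync bcAlph bcTrans q.bc e q'.bc ∧
  sync scAlph cT q.sc e q'.sc

/-- Runs of the composition: `Reach step q0 s q` iff the string `s` can be executed from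
`q0`, ending in global state `q`. -/
inductive Reach (step : GSt → Ev → GSt → Prop) (q0 : GSt) : List Ev → GSt → Prop
  | nil : Reach step q0 [] q0
  | snoc {s : List Ev} {q : GSt} {e : Ev} {q' : GSt} :
      Reach step q0 s q → step q e q' → Reach step q0 (s ++ [e]) q'

/-- Initial global state. -/
def init : GSt := ⟨.s0, .r0, .f0, .b0, .c0⟩

/-- Generated language of the composition. -/
def Lang (step : GSt → Ev → GSt → Prop) : Set (List Ev) :=
  {s | ∃ q, Reach step init s q}

/-! Abstract supervisory-control notions on languages. -/

/-- Prefix closure `pr(K)`. -/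
def prefixClosure {A : Type*} (K : Set (List A)) : Set (List A) := {s | ∃ t ∈ K, s <+: t}

/-- Controllability of `K` w.r.t. `(L, Auc)`. -/
def IsControllable {A : Type*} (K L : Set (List A)) (Auc : Set A) : Prop :=
  ∀ s ∈ prefixClosure K, ∀ σ ∈ Auc, s ++ [σ] ∈ L → s ++ [σ] ∈ prefixClosure K

/-- Normality of `K` w.r.t. `(L, P)`: `pr(K) = P⁻¹(P(pr(K))) ∩ L`. -/
def IsNormalLang {A : Type*} (K L : Set (List A)) (P : List A → List A) : Prop :=
  prefixClosure K = {s | ∃ t ∈ prefixClosure K, P s = P t} ∩ L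

/-- Sender transitions with the dead transitions
`s0 −a0'→ s0`, `s2 −send→ s1`, `s4 −a1'→ s5`, `s6 −send→ s5` removed. -/
def sndTrans' : List (SSt × Ev × SSt) :=
  [(.s0, .a1', .s0), (.s0, .timeout, .s0), (.s0, .send, .s1),
   (.s1, .p0, .s2), (.s2, .timeout, .s1), (.s2, .a1', .s2), (.s2, .a0', .s3),
   (.s3, .done, .s4), (.s4, .a0', .s4), (.s4, .timeout, .s4), (.s4, .send, .s5),
   (.s5, .p1, .s6), (.s6, .timeout, .s5), (.s6, .a1', .s7), (.s7, .done, .s0)]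

/-- Sending client with the dead transition `c0 −done→ c0` removed. -/
def scTrans' : List (CSt × Ev × CSt) :=
  [(.c0, .send, .c1), (.c1, .done, .c0)]

/-- Forward channel under the person-in-the-middle attack. -/
def fcTransAtk : List (FSt × Ev × FSt) :=
  fcTrans ++
  [(.f1, .p1', .f1), (.f1, .p1', .f0), (.f2, .p0', .f2), (.f2, .p0', .f0)]

/-- The attacked ABP system `G_a'` without dead transitions (forward channel attacked). -/
def atkStep' : GSt → Ev → GSt → Prop := gstep sndTrans' fcTransAtk scTrans'

/-- Uncontrollable events for the attacker. -/
def Euc : Set Ev :=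
  {e | e ∈ ([.send, .done, .timeout, .deliver, .p0, .p1, .a0, .a1] : List Ev)}

/-- Natural projection onto the attacker's observable events
`Eo = {p0, p1, p0', p1', a0, a1, a0', a1'}`. -/
def P (s : List Ev) : List Ev :=
  s.filter (fun e => decide (e ∈ ([.p0, .p1, .p0', .p1', .a0, .a1, .a0', .a1'] : List Ev)))

/-- The attacker's specification language: strings of `L(G_a')` whose `{send, deliver}`
subsequence is *not* a prefix of the alternating sequence `send, deliver, send, …`. -/
def M : Set (List Ev) :=
  {s | s ∈ Lang atkStep' ∧
    ¬ ∃ n : ℕ,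
        s.filter (fun e => decide (e = Ev.send ∨ e = Ev.deliver)) <+:
          (List.replicate n [Ev.send, Ev.deliver]).flatten}

section Reachability

variable {step : GSt → Ev → GSt → Prop} {q₀ q q' : GSt} {s w : List Ev}

lemma Reach.trans (h : Reach step q₀ s q) (h' : Reach step q w q') :
    Reach step q₀ (s ++ w) q' := by
  induction h' with
  | nil => simpa using h
  | snoc _ hs ih => simpa using ih.snoc hs

lemma Reach.cons {e : Ev} (h : step q₀ e q) (h' : Reach step q w q') :
    Reach step q₀ (e :: w) q' := by
  simpa using Reach.trans (by simpa using Reach.nil.snoc h : Reach step q₀ [e] q) h'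

lemma Reach.exists_of_prefix {t : List Ev} (h : Reach step q₀ t q) (hs : s <+: t) :
    ∃ p, Reach step q₀ s p := by
  induction h with
  | nil => exact ⟨q₀, by simpa [List.prefix_nil.mp hs] using Reach.nil⟩
  | snoc hr hstep ih =>
    rcases List.prefix_concat_iff.mp hs with rfl | hs
    · exact ⟨_, hr.snoc hstep⟩
    · exact ih hs

end Reachability

lemma subset_prefixClosure {A : Type*} (K : Set (List A)) : K ⊆ prefixClosure K :=
  fun s hs => ⟨s, hs, List.prefix_refl s⟩

lemma prefixClosure_Lang (step : GSt → Ev → GSt → Prop) :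
    prefixClosure (Lang step) = Lang step :=
  Set.Subset.antisymm (fun _ ⟨_, ⟨_, hq⟩, hst⟩ => hq.exists_of_prefix hst)
    (subset_prefixClosure _)

/-- The alternating sequence never repeats an event. -/
lemma isChain_ne_alternating (n : ℕ) :
    List.IsChain (· ≠ ·) (List.replicate n [Ev.send, Ev.deliver]).flatten := by
  induction n with
  | zero => simp
  | succ n ih =>
    cases n with
    | zero => simp
    | succ n => simpa [List.replicate_succ] using ih

/-- Two deliveries without a `send` in between violate alternation, whatever came before. -/
lemma not_alternating_of_deliver_twice (s : List Ev) :
    ¬ ∃ n : ℕ,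
      (s ++ ([.deliver, .a0, .p1', .deliver] : List Ev)).filter
          (fun e => decide (e = Ev.send ∨ e = Ev.deliver)) <+:
        (List.replicate n [Ev.send, Ev.deliver]).flatten := by
  rintro ⟨n, hn⟩
  have h := (isChain_ne_alternating n).prefix hn
  rw [List.filter_append] at h
  simpa using h.right_of_append

/-- The client has an outstanding request unless the sender is idle. -/
def ClientSync (q : GSt) : Prop := q.sc = .c0 ↔ q.snd = .s0 ∨ q.snd = .s4

lemma ClientSync.of_step {q q' : GSt} {e : Ev} (h : ClientSync q) (hs : atkStep' q e q') :
    ClientSync q' := by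
  obtain ⟨hsnd, -, -, -, hsc⟩ := hs
  obtain ⟨a, _, _, _, c⟩ := q
  obtain ⟨a', _, _, _, c'⟩ := q'
  cases a <;> cases c <;> cases e <;>
    simp_all [ClientSync, sync, sndAlph, scAlph, sndTrans', scTrans']

lemma ClientSync.of_reach {s : List Ev} {q : GSt} (h : Reach atkStep' init s q) :
    ClientSync q := by
  induction h with
  | nil => simp [ClientSync, init]
  | snoc _ hs ih => exact ih.of_step hs

lemma atkStep'_iff (a a' : SSt) (r r' : RSt) (f f' : FSt) (b b' : BSt) (c c' : CSt) (e : Ev) :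
    atkStep' ⟨a, r, f, b, c⟩ e ⟨a', r', f', b', c'⟩ ↔
      sync sndAlph sndTrans' a e a' ∧ sync rcvAlph rcvTrans r e r' ∧
      sync fcAlph fcTransAtk f e f' ∧ sync bcAlph bcTrans b e b' ∧
      sync scAlph scTrans' c e c' := Iff.rfl

/-- From a synchronized state the sender can put a message into the forward channel. -/
lemma ClientSync.exists_reach_fc_ne {q : GSt} (h : ClientSync q) :
    ∃ w q', Reach atkStep' q w q' ∧ q'.fc ≠ .f0 := by
  obtain ⟨a, r, f, b, c⟩ := q
  by_cases hf : f = .f0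
  swap
  · exact ⟨[], _, .nil, hf⟩
  subst hf
  have mv : ∀ {a a' c c' f' e}, sync sndAlph sndTrans' a e a' → sync scAlph scTrans' c e c' →
      sync fcAlph fcTransAtk .f0 e f' → ¬ rcvAlph e → ¬ bcAlph e →
      (∃ w q', Reach atkStep' ⟨a', r, f', b, c'⟩ w q' ∧ q'.fc ≠ .f0) →
      ∃ w q', Reach atkStep' ⟨a, r, .f0, b, c⟩ w q' ∧ q'.fc ≠ .f0 :=
    fun ha hc hf hr hb ⟨w, q', hw, hq'⟩ =>
      ⟨_, q', .cons (q := ⟨_, _, _, _, _⟩) ⟨ha, .inr ⟨hr, rfl⟩, hf, .inr ⟨hb, rfl⟩, hc⟩ hw, hq'⟩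
  simp only [sync, sndAlph, rcvAlph, fcAlph, bcAlph, scAlph] at mv
  have h1 : ∃ w q', Reach atkStep' ⟨.s1, r, .f0, b, .c1⟩ w q' ∧ q'.fc ≠ .f0 :=
    mv (e := .p0) (a' := .s2) (c' := .c1) (f' := .f1) (by decide) (by decide) (by decide)
      (by decide) (by decide) ⟨[], _, .nil, by simp⟩
  have h5 : ∃ w q', Reach atkStep' ⟨.s5, r, .f0, b, .c1⟩ w q' ∧ q'.fc ≠ .f0 :=
    mv (e := .p1) (a' := .s6) (c' := .c1) (f' := .f2) (by decide) (by decide) (by decide)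
      (by decide) (by decide) ⟨[], _, .nil, by simp⟩
  have h0 := mv (e := .send) (a := .s0) (c := .c0) (by decide) (by decide) (by decide)
    (by decide) (by decide) h1
  have h2 := mv (e := .timeout) (a := .s2) (c := .c1) (by decide) (by decide) (by decide)
    (by decide) (by decide) h1
  have h4 := mv (e := .send) (a := .s4) (c := .c0) (by decide) (by decide) (by decide)
    (by decide) (by decide) h5
  have h6 := mv (e := .timeout) (a := .s6) (c := .c1) (by decide) (by decide) (by decide)
    (by decide) (by decide) h5
  have h3 := mv (e := .done) (a := .s3) (c := .c1) (by decide) (by decide) (by decide)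
    (by decide) (by decide) h4
  have h7 := mv (e := .done) (a := .s7) (c := .c1) (by decide) (by decide) (by decide)
    (by decide) (by decide) h0
  cases a <;> cases c <;> first | assumption | simp [ClientSync] at h

/-- With a message in the forward channel, the attacker can cause two deliveries without a
`send` in between, from every receiver state. -/
lemma exists_reach_deliver_twice {q : GSt} (hq : q.fc ≠ .f0) :
    ∃ w q', Reach atkStep' q (w ++ [.deliver, .a0, .p1', .deliver]) q' := by
  obtain ⟨a, r, f, b, c⟩ := q
  have mv : ∀ {r r' e}, (r, e, r') ∈ rcvTrans →
      atkStep' ⟨a, r, f, b, c⟩ e ⟨a, r', f, b, c⟩ := by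
    intro r r' e h
    simp only [rcvTrans, List.mem_cons, Prod.mk.injEq, List.not_mem_nil, or_false] at h
    rcases h with h | h | h | h | h | h | h | h <;> obtain ⟨rfl, rfl, rfl⟩ := h <;>
      cases f <;> cases b <;>
      simp_all [atkStep'_iff, sync, sndAlph, rcvAlph, fcAlph, bcAlph, scAlph, rcvTrans,
        fcTransAtk, fcTrans, bcTrans]
  have h1 : Reach atkStep' ⟨a, .r1, f, b, c⟩ [.deliver, .a0, .p1', .deliver]
      ⟨a, .r0, f, b, c⟩ :=
    .cons (mv (r' := .r2) (by simp [rcvTrans])) <| .cons (mv (r' := .r3) (by simp [rcvTrans])) <|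
      .cons (mv (r' := .r4) (by simp [rcvTrans])) <| .cons (mv (by simp [rcvTrans])) .nil
  have h0 := Reach.cons (mv (r := .r0) (e := .p0') (by simp [rcvTrans])) h1
  have h4 := Reach.cons (mv (r := .r4) (e := .deliver) (by simp [rcvTrans])) h0
  have h3 := Reach.cons (mv (r := .r3) (e := .p1') (by simp [rcvTrans])) h4
  have h2 := Reach.cons (mv (r := .r2) (e := .a0) (by simp [rcvTrans])) h3
  have h5 := Reach.cons (mv (r := .r5) (e := .a1) (by simp [rcvTrans])) h0
  cases r
  · exact ⟨[.p0'], _, h0⟩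
  · exact ⟨[], _, h1⟩
  · exact ⟨[.a0, .p1', .deliver, .p0'], _, h2⟩
  · exact ⟨[.p1', .deliver, .p0'], _, h3⟩
  · exact ⟨[.deliver, .p0'], _, h4⟩
  · exact ⟨[.a1, .p0'], _, h5⟩

lemma prefixClosure_M : prefixClosure M = Lang atkStep' := by
  refine Set.Subset.antisymm ?_ ?_
  · rintro s ⟨t, ⟨ht, -⟩, hst⟩
    exact prefixClosure_Lang atkStep' ▸ ⟨t, ht, hst⟩
  · rintro s ⟨q, hq⟩
    obtain ⟨u, p, hu, hp⟩ := (ClientSync.of_reach hq).exists_reach_fc_ne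
    obtain ⟨w, p', hw⟩ := exists_reach_deliver_twice hp
    refine ⟨(s ++ u ++ w) ++ [.deliver, .a0, .p1', .deliver],
      ⟨⟨p', ?_⟩, not_alternating_of_deliver_twice _⟩, ?_⟩
    · simpa using (hq.trans hu).trans hw
    · simp

lemma attack_mem_M :
    ([.send, .p0, .p0', .deliver, .a0, .p1', .deliver] : List Ev) ∈ M := by
  refine ⟨⟨⟨.s2, .r0, .f1, .b0, .c1⟩, ?_⟩, not_alternating_of_deliver_twice [.send, .p0, .p0']⟩
  refine .cons (q := ⟨.s1, .r0, .f0, .b0, .c1⟩) ?_ <|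
    .cons (q := ⟨.s2, .r0, .f1, .b0, .c1⟩) ?_ <|
    .cons (q := ⟨.s2, .r1, .f1, .b0, .c1⟩) ?_ <|
    .cons (q := ⟨.s2, .r2, .f1, .b0, .c1⟩) ?_ <|
    .cons (q := ⟨.s2, .r3, .f1, .b0, .c1⟩) ?_ <|
    .cons (q := ⟨.s2, .r4, .f1, .b0, .c1⟩) ?_ <| .cons ?_ .nil <;>
  simp [init, atkStep'_iff, sync, sndAlph, rcvAlph, fcAlph, bcAlph, scAlph, sndTrans', rcvTrans,
    fcTransAtk, fcTrans, bcTrans, scTrans']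

/-- with the dead transitions removed, the safety-violation language `M`
is controllable w.r.t. `(L(G_a'), Euc)`, normal w.r.t. `(L(G_a'), P)`, and
`pr(M) = L(G_a')`; in particular `send · p0 · p0' · deliver · a0 · p1' · deliver ∈ M`. -/
theorem stmt9 :
    IsControllable M (Lang atkStep') Euc ∧
    IsNormalLang M (Lang atkStep') P ∧
    prefixClosure M = Lang atkStep' ∧
    ([.send, .p0, .p0', .deliver, .a0, .p1', .deliver] : List Ev) ∈ M := by
  refine ⟨?_, ?_, prefixClosure_M, attack_mem_M⟩
  · intro s _ σ _ h
    rwa [prefixClosure_M]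
  · rw [IsNormalLang, prefixClosure_M]
    exact Set.Subset.antisymm (fun s hs => ⟨⟨s, hs, rfl⟩, hs⟩) Set.inter_subset_right
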